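/- Let d be an even positive integer and apply the directional CSS construction of the word W = NE²NE²N with the row-alternating layout on the thin-rectangle torus with (L_x, L_y) = (2d, d), so n = d². Then the logical dimension satisfies k = 4 if 6 divides d, and k = 0 otherwise. -/

import Mathlib

/-- The torus `G = (ℤ/L_x) × (ℤ/L_y)`. -/
abbrev Torus (Lx Ly : ℕ) := ZMod Lx × ZMod Ly

/-- The parity map `π : G → ℤ/2`, `π(x, y) = x + y mod 2` (well defined since
`2 ∣ L_x` and `2 ∣ L_y`). -/
def torusParity {Lx Ly : ℕ} (hx : 2 ∣ Lx) (hy : 2 ∣ Ly) (p : Torus Lx Ly) : ZMod 2 :=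
  ZMod.castHom hx (ZMod 2) p.1 + ZMod.castHom hy (ZMod 2) p.2

/-- Data sites `Λ_Q = π⁻¹(0)`. -/
abbrev DataSite (Lx Ly : ℕ) (hx : 2 ∣ Lx) (hy : 2 ∣ Ly) :=
  {p : Torus Lx Ly // torusParity hx hy p = 0}

/-- X-ancillas under row alternation: `π(p) = 1` and `y ≡ 0 (mod 2)`. -/
abbrev XAncilla (Lx Ly : ℕ) (hx : 2 ∣ Lx) (hy : 2 ∣ Ly) :=
  {p : Torus Lx Ly // torusParity hx hy p = 1 ∧ ZMod.castHom hy (ZMod 2) p.2 = 0}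

/-- Z-ancillas under row alternation: `π(p) = 1` and `y ≡ 1 (mod 2)`. -/
abbrev ZAncilla (Lx Ly : ℕ) (hx : 2 ∣ Lx) (hy : 2 ∣ Ly) :=
  {p : Torus Lx Ly // torusParity hx hy p = 1 ∧ ZMod.castHom hy (ZMod 2) p.2 = 1}

/-- The offset list of the word `W = NE²NE²N`. -/
def offsets : List (ℤ × ℤ) := [(0, 1), (1, 2), (3, 2), (4, 3), (5, 4), (7, 4), (8, 5)]

/-- Reduction of an integer offset into the torus. -/
def toTorus (Lx Ly : ℕ) (q : ℤ × ℤ) : Torus Lx Ly := ((q.1 : ZMod Lx), (q.2 : ZMod Ly))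

/-- The X-check matrix `H_X ∈ F₂^{Λ_X × Λ_Q}`:
`H_X(a, q) = #{j : q = a + Q_j} mod 2`. -/
def HX (Lx Ly : ℕ) (hx : 2 ∣ Lx) (hy : 2 ∣ Ly) :
    Matrix (XAncilla Lx Ly hx hy) (DataSite Lx Ly hx hy) (ZMod 2) :=
  fun a q =>
    ((offsets.countP fun Qj => decide ((q : Torus Lx Ly) = a + toTorus Lx Ly Qj)) : ℕ)

/-- The Z-check matrix `H_Z ∈ F₂^{Λ_Z × Λ_Q}`:
`H_Z(a, q) = #{j : q = a + Q_j} mod 2`. -/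
def HZ (Lx Ly : ℕ) (hx : 2 ∣ Lx) (hy : 2 ∣ Ly) :
    Matrix (ZAncilla Lx Ly hx hy) (DataSite Lx Ly hx hy) (ZMod 2) :=
  fun a q =>
    ((offsets.countP fun Qj => decide ((q : Torus Lx Ly) = a + toTorus Lx Ly Qj)) : ℕ)

/-- The logical dimension `k = n − rank(H_X) − rank(H_Z)` with `n = |Λ_Q|`. -/
noncomputable def kDim (Lx Ly : ℕ) [NeZero Lx] [NeZero Ly]
    (hx : 2 ∣ Lx) (hy : 2 ∣ Ly) : ℕ :=
  Fintype.card (DataSite Lx Ly hx hy) - (HX Lx Ly hx hy).rank - (HZ Lx Ly hx hy).rank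

/-- The ancillas of row parity `ε`: `ε = 0` gives `XAncilla`, `ε = 1` gives `ZAncilla`. -/
abbrev RowAncilla (Lx Ly : ℕ) (hx : 2 ∣ Lx) (hy : 2 ∣ Ly) (ε : ZMod 2) :=
  {p : Torus Lx Ly // torusParity hx hy p = 1 ∧ ZMod.castHom hy (ZMod 2) p.2 = ε}

/-- The check matrix of row parity `ε`, specializing to `HX` and `HZ`. -/
def rowCheck (Lx Ly : ℕ) (hx : 2 ∣ Lx) (hy : 2 ∣ Ly) (ε : ZMod 2) :
    Matrix (RowAncilla Lx Ly hx hy ε) (DataSite Lx Ly hx hy) (ZMod 2) :=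
  fun a q =>
    ((offsets.countP fun Qj => decide ((q : Torus Lx Ly) = a + toTorus Lx Ly Qj)) : ℕ)

section Cardinality

theorem card_fiber_mul_card {A B : Type*} [AddGroup A] [AddGroup B] [Finite A]
    (f : A →+ B) (hf : Function.Surjective f) (b : B) :
    Nat.card {a // f a = b} * Nat.card B = Nat.card A := by
  obtain ⟨a₀, rfl⟩ := hf b
  have e : {a // f a = f a₀} ≃ f.ker :=
    { toFun := fun a => ⟨a - a₀, by simp [AddMonoidHom.mem_ker, a.2]⟩
      invFun := fun a => ⟨a + a₀, by
        have := a.2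
        rw [AddMonoidHom.mem_ker] at this
        simp [this]⟩
      left_inv := fun a => by simp
      right_inv := fun a => by simp }
  rw [Nat.card_congr e, ← Nat.card_congr
    (QuotientAddGroup.quotientKerEquivOfSurjective f hf).toEquiv, mul_comm]
  exact (AddSubgroup.card_eq_card_quotient_mul_card_addSubgroup _).symm

variable {Lx Ly : ℕ} (hx : 2 ∣ Lx) (hy : 2 ∣ Ly)

/-- The parity map as an additive homomorphism. -/
def torusParityHom : Torus Lx Ly →+ ZMod 2 where
  toFun := torusParity hx hy
  map_zero' := by simp [torusParity]
  map_add' p q := by simp only [torusParity, Prod.fst_add, Prod.snd_add, map_add]; ring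

/-- The additive homomorphism recording the parity and the row parity of a site. -/
def torusRowParityHom : Torus Lx Ly →+ ZMod 2 × ZMod 2 :=
  (torusParityHom hx hy).prod
    ((ZMod.castHom hy (ZMod 2)).toAddMonoidHom.comp (AddMonoidHom.snd _ _))

theorem torusRowParityHom_surjective : Function.Surjective (torusRowParityHom hx hy) := by
  rintro ⟨a, b⟩
  obtain ⟨y, rfl⟩ := ZMod.castHom_surjective hy b
  obtain ⟨x, hx'⟩ := ZMod.castHom_surjective hx (a - ZMod.castHom hy (ZMod 2) y)
  refine ⟨(x, y), Prod.ext ?_ rfl⟩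
  change ZMod.castHom hx (ZMod 2) x + ZMod.castHom hy (ZMod 2) y = a
  rw [hx', sub_add_cancel]

theorem card_dataSite_mul_two [NeZero Lx] [NeZero Ly] :
    Fintype.card (DataSite Lx Ly hx hy) * 2 = Lx * Ly := by
  have h := card_fiber_mul_card (torusParityHom hx hy)
    (Prod.fst_surjective.comp (torusRowParityHom_surjective hx hy)) 0
  rw [Nat.card_prod, Nat.card_zmod, Nat.card_zmod, Nat.card_zmod] at h
  rw [← Nat.card_eq_fintype_card]
  exact h

theorem card_rowAncilla_mul_four [NeZero Lx] [NeZero Ly] (ε : ZMod 2) :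
    Fintype.card (RowAncilla Lx Ly hx hy ε) * 4 = Lx * Ly := by
  have h := card_fiber_mul_card (torusRowParityHom hx hy)
    (torusRowParityHom_surjective hx hy) (1, ε)
  rw [Nat.card_prod, Nat.card_prod, Nat.card_zmod, Nat.card_zmod, Nat.card_zmod] at h
  rw [← Nat.card_eq_fintype_card, ← h]
  congr 1
  exact Nat.card_congr (Equiv.subtypeEquivRight fun p => Prod.mk_inj.symm)

end Cardinality

section Kernel

variable {Lx Ly : ℕ} {hx : 2 ∣ Lx} {hy : 2 ∣ Ly} {ε : ZMod 2}

theorem exists_eq_two_mul_of_castHom_eq_zero {n : ℕ} [NeZero n] (h : 2 ∣ n) {z : ZMod n}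
    (hz : ZMod.castHom h (ZMod 2) z = 0) : ∃ k : ℕ, z = 2 * k := by
  rw [← ZMod.natCast_zmod_val z, map_natCast, ZMod.natCast_eq_zero_iff] at hz
  obtain ⟨k, hk⟩ := hz
  exact ⟨k, by rw [← ZMod.natCast_zmod_val z, hk]; push_cast; rfl⟩

theorem castHom_sub_even {n : ℕ} (h : 2 ∣ n) (z : ZMod n) (m : ℕ) [m.AtLeastTwo]
    (hm : Even m) :
    ZMod.castHom h (ZMod 2) (z - OfNat.ofNat m) = ZMod.castHom h (ZMod 2) z := by
  have h0 : (OfNat.ofNat m : ZMod 2) = 0 := (ZMod.natCast_eq_zero_iff m 2).2 hm.two_dvd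
  rw [map_sub, map_ofNat, h0, sub_zero]

theorem zmod_two_eq_of_add_eq_zero {a b : ZMod 2} (h : a + b = 0) : a = b := by
  rw [← sub_eq_zero, CharTwo.sub_eq_add, h]

/-- Extension by zero of a function on the ancillas to the whole torus. -/
noncomputable def extendByZero (v : RowAncilla Lx Ly hx hy ε → ZMod 2) (p : Torus Lx Ly) :
    ZMod 2 :=
  Function.extend Subtype.val v 0 p

theorem extendByZero_coe (v : RowAncilla Lx Ly hx hy ε → ZMod 2)
    (a : RowAncilla Lx Ly hx hy ε) : extendByZero v a = v a :=
  Subtype.val_injective.extend_apply _ _ _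

theorem extendByZero_eq_zero (v : RowAncilla Lx Ly hx hy ε → ZMod 2) {p : Torus Lx Ly}
    (hp : ¬ (torusParity hx hy p = 1 ∧ ZMod.castHom hy (ZMod 2) p.2 = ε)) :
    extendByZero v p = 0 :=
  Function.extend_apply' _ _ _ (by rintro ⟨a, rfl⟩; exact hp a.2)

theorem sum_countP_mul [NeZero Lx] [NeZero Ly] (l : List (ℤ × ℤ)) (f : Torus Lx Ly → ZMod 2)
    (q : Torus Lx Ly) :
    ∑ p, ((l.countP fun Q => decide (q = p + toTorus Lx Ly Q) : ℕ) : ZMod 2) * f p =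
      (l.map fun Q => f (q - toTorus Lx Ly Q)).sum := by
  induction l with
  | nil => simp
  | cons Q l ih =>
    simp only [List.countP_cons, Nat.cast_add, add_mul, Finset.sum_add_distrib, ih,
      List.map_cons, List.sum_cons, decide_eq_true_eq, Nat.cast_ite, Nat.cast_one,
      Nat.cast_zero, ite_mul, one_mul, zero_mul]
    rw [add_comm]
    congr 1
    simp [← sub_eq_iff_eq_add]

theorem rowCheck_transpose_mulVec [NeZero Lx] [NeZero Ly]
    (v : RowAncilla Lx Ly hx hy ε → ZMod 2) (q : DataSite Lx Ly hx hy) :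
    ((rowCheck Lx Ly hx hy ε).transpose.mulVec v) q =
      (offsets.map fun Q => extendByZero v (q.1 - toTorus Lx Ly Q)).sum := by
  rw [← sum_countP_mul]
  refine Fintype.sum_of_injective Subtype.val Subtype.val_injective _ _ ?_ ?_
  · intro p hp
    rw [extendByZero_eq_zero v fun h => hp ⟨⟨p, h⟩, rfl⟩, mul_zero]
  · intro a
    rw [extendByZero_coe]
    rfl

/-- `f` is invariant under horizontal translation by `2` and its values at three
consecutive sites with vertical spacing `2` sum to zero. -/
def IsColumnPeriodic (f : Torus Lx Ly → ZMod 2) : Prop :=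
  (∀ x y, f (x - 2, y) = f (x, y)) ∧ ∀ x y, f (x, y) + f (x, y - 2) + f (x, y - 4) = 0

theorem mulVec_eq_zero_of_isColumnPeriodic [NeZero Lx] [NeZero Ly]
    {v : RowAncilla Lx Ly hx hy ε → ZMod 2} (h : IsColumnPeriodic (extendByZero v)) :
    (rowCheck Lx Ly hx hy ε).transpose.mulVec v = 0 := by
  funext ⟨⟨x, y⟩, hq⟩
  obtain ⟨hX, hY⟩ := h
  rw [rowCheck_transpose_mulVec]
  simp only [offsets, toTorus, List.map_cons, List.map_nil, List.sum_cons, List.sum_nil,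
    Prod.mk_sub_mk, Pi.zero_apply]
  push_cast
  rw [show x - 3 = x - 1 - 2 by ring, show x - 7 = x - 5 - 2 by ring,
    show x - 8 = x - 2 - 2 - 2 - 2 by ring, show x - 4 = x - 2 - 2 by ring,
    show y - 5 = y - 1 - 4 by ring, show y - 3 = y - 1 - 2 by ring]
  simp only [hX, sub_zero]
  linear_combination hY x (y - 1) + CharTwo.add_self_eq_zero (extendByZero v (x - 1, y - 2)) +
    CharTwo.add_self_eq_zero (extendByZero v (x - 5, y - 4))

theorem isColumnPeriodic_of_mulVec_eq_zero [NeZero Lx] [NeZero Ly]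
    {v : RowAncilla Lx Ly hx hy ε → ZMod 2}
    (h : (rowCheck Lx Ly hx hy ε).transpose.mulVec v = 0) :
    IsColumnPeriodic (extendByZero v) := by
  have two : (2 : ZMod 2) = 0 := by decide
  have three : (3 : ZMod 2) = 1 := by decide
  have sum_eq_zero (q : Torus Lx Ly) (hq : torusParity hx hy q = 0) :
      (offsets.map fun Q => extendByZero v (q - toTorus Lx Ly Q)).sum = 0 := by
    rw [← rowCheck_transpose_mulVec v ⟨q, hq⟩, h, Pi.zero_apply]
  have vanish_of_row {y : ZMod Ly} (hrow : ZMod.castHom hy (ZMod 2) y = ε) (x : ZMod Lx) :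
      extendByZero v (x, y + 1) = 0 ∧ extendByZero v (x, y - 1) = 0 ∧
        extendByZero v (x, y - 3) = 0 := by
    have vanish (y' : ZMod Ly) (hy' : ZMod.castHom hy (ZMod 2) y' = ε + 1) :
        extendByZero v (x, y') = 0 :=
      extendByZero_eq_zero v fun h' => by simp [-ZMod.castHom_apply, hy'] at h'
    refine ⟨vanish _ ?_, vanish _ ?_, vanish _ ?_⟩ <;>
      simp only [map_add, map_sub, map_one, map_ofNat, hrow, three, CharTwo.sub_eq_add]
  have vanish_of_parity {x : ZMod Lx} {y : ZMod Ly}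
      (hp : ¬ (torusParity hx hy (x, y) = 1 ∧ ZMod.castHom hy (ZMod 2) y = ε))
      (x' : ZMod Lx) (y' : ZMod Ly)
      (hx' : ZMod.castHom hx (ZMod 2) x' = ZMod.castHom hx (ZMod 2) x)
      (hy' : ZMod.castHom hy (ZMod 2) y' = ZMod.castHom hy (ZMod 2) y) :
      extendByZero v (x', y') = 0 :=
    extendByZero_eq_zero v fun h' => hp (by simpa only [torusParity, hx', hy'] using h')
  have three_term (x : ZMod Lx) (y : ZMod Ly) : extendByZero v (x, y) +
      extendByZero v (x - 4, y - 2) + extendByZero v (x - 8, y - 4) = 0 := by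
    by_cases hp : torusParity hx hy (x, y) = 1 ∧ ZMod.castHom hy (ZMod 2) y = ε
    · have hs := sum_eq_zero (x, y + 1) (by
        have := hp.1
        simp only [torusParity, map_add, map_one] at this ⊢
        linear_combination this + two)
      simp only [offsets, toTorus, List.map_cons, List.map_nil, List.sum_cons, List.sum_nil,
        Prod.mk_sub_mk] at hs
      push_cast at hs
      rw [show y + 1 - 2 = y - 1 by ring, show y + 1 - 4 = y - 3 by ring] at hs
      simp only [vanish_of_row hp.2] at hs
      rw [show y + 1 - 1 = y by ring, show y + 1 - 3 = y - 2 by ring,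
        show y + 1 - 5 = y - 4 by ring, sub_zero] at hs
      linear_combination hs
    · have vanish := vanish_of_parity hp
      rw [vanish x y rfl rfl, vanish (x - 4) (y - 2) (castHom_sub_even hx x 4 (by decide))
          (castHom_sub_even hy y 2 (by decide)),
        vanish (x - 8) (y - 4) (castHom_sub_even hx x 8 (by decide))
          (castHom_sub_even hy y 4 (by decide)), add_zero, add_zero]
  have four_term (x : ZMod Lx) (y : ZMod Ly) : extendByZero v (x, y) +
      extendByZero v (x - 2, y) + extendByZero v (x - 4, y - 2) +
      extendByZero v (x - 6, y - 2) = 0 := by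
    by_cases hp : torusParity hx hy (x, y) = 1 ∧ ZMod.castHom hy (ZMod 2) y = ε
    · have hs := sum_eq_zero (x + 1, y + 2) (by
        have := hp.1
        simp only [torusParity, map_add, map_one, map_ofNat] at this ⊢
        linear_combination this + 2 * two)
      simp only [offsets, toTorus, List.map_cons, List.map_nil, List.sum_cons, List.sum_nil,
        Prod.mk_sub_mk] at hs
      push_cast at hs
      rw [show y + 2 - 1 = y + 1 by ring, show y + 2 - 3 = y - 1 by ring,
        show y + 2 - 5 = y - 3 by ring] at hs
      simp only [vanish_of_row hp.2] at hs
      rw [show y + 2 - 2 = y by ring, show y + 2 - 4 = y - 2 by ring,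
        show x + 1 - 1 = x by ring, show x + 1 - 3 = x - 2 by ring,
        show x + 1 - 5 = x - 4 by ring, show x + 1 - 7 = x - 6 by ring] at hs
      linear_combination hs
    · have vanish := vanish_of_parity hp
      rw [vanish x y rfl rfl, vanish (x - 2) y (castHom_sub_even hx x 2 (by decide)) rfl,
        vanish (x - 4) (y - 2) (castHom_sub_even hx x 4 (by decide))
          (castHom_sub_even hy y 2 (by decide)),
        vanish (x - 6) (y - 2) (castHom_sub_even hx x 6 (by decide))
          (castHom_sub_even hy y 2 (by decide)), add_zero, add_zero, add_zero]
  have hX (x : ZMod Lx) (y : ZMod Ly) :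
      extendByZero v (x - 2, y) = extendByZero v (x, y) := by
    have h1 := three_term x y
    have h2 := three_term (x - 2) y
    have h3 := four_term (x - 4) (y - 2)
    rw [show x - 2 - 4 = x - 6 by ring, show x - 2 - 8 = x - 10 by ring] at h2
    rw [show x - 4 - 2 = x - 6 by ring, show x - 4 - 4 = x - 8 by ring,
      show x - 4 - 6 = x - 10 by ring, show y - 2 - 2 = y - 4 by ring] at h3
    exact (zmod_two_eq_of_add_eq_zero (by linear_combination h1 + h2 - h3)).symm
  refine ⟨hX, fun x y => ?_⟩
  have h1 := three_term x y
  rwa [show x - 8 = x - 2 - 2 - 2 - 2 by ring, show x - 4 = x - 2 - 2 by ring, hX, hX, hX, hX,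
    hX, hX] at h1

/-- A site in the ancilla class of row parity `ε`. -/
def baseSite (Lx Ly : ℕ) (ε : ZMod 2) : Torus Lx Ly := ((1 + ε.val : ℕ), (ε.val : ℕ))

theorem baseSite_mem [NeZero Lx] [NeZero Ly] (k i : ℕ) :
    torusParity hx hy ((baseSite Lx Ly ε).1 + 2 * k, (baseSite Lx Ly ε).2 + 2 * i) = 1 ∧
      ZMod.castHom hy (ZMod 2) ((baseSite Lx Ly ε).2 + 2 * i) = ε := by
  have two : (2 : ZMod 2) = 0 := by decide
  simp only [torusParity, baseSite, Nat.cast_add, Nat.cast_one, map_add, map_mul, map_natCast,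
    map_one, map_ofNat, ZMod.natCast_zmod_val]
  constructor
  · linear_combination (ε + k + i) * two
  · linear_combination i * two

theorem exists_eq_baseSite_add [NeZero Lx] [NeZero Ly] {p : Torus Lx Ly}
    (hp : torusParity hx hy p = 1 ∧ ZMod.castHom hy (ZMod 2) p.2 = ε) :
    ∃ k i : ℕ, p = ((baseSite Lx Ly ε).1 + 2 * k, (baseSite Lx Ly ε).2 + 2 * i) := by
  have two : (2 : ZMod 2) = 0 := by decide
  obtain ⟨h1, h2⟩ := hp
  rw [torusParity, h2] at h1
  obtain ⟨k, hk⟩ := exists_eq_two_mul_of_castHom_eq_zero hx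
    (z := p.1 - (baseSite Lx Ly ε).1) (by
      simp only [baseSite, Nat.cast_add, Nat.cast_one, map_sub, map_add, map_one, map_natCast,
        ZMod.natCast_zmod_val]
      linear_combination h1 - ε * two)
  obtain ⟨i, hi⟩ := exists_eq_two_mul_of_castHom_eq_zero hy
    (z := p.2 - (baseSite Lx Ly ε).2) (by
      simp only [baseSite, map_sub, map_natCast, ZMod.natCast_zmod_val]
      linear_combination h2)
  exact ⟨k, i, Prod.ext (by linear_combination hk) (by linear_combination hi)⟩

theorem IsColumnPeriodic.apply_add {f : Torus Lx Ly → ZMod 2} (hf : IsColumnPeriodic f)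
    (x : ZMod Lx) (y : ZMod Ly) (k : ℕ) : f (x + 2 * k, y) = f (x, y) := by
  induction k with
  | zero => simp
  | succ k ih =>
    rw [← ih, ← hf.1]
    congr 2
    push_cast
    ring

theorem IsColumnPeriodic.apply_add_six {f : Torus Lx Ly → ZMod 2} (hf : IsColumnPeriodic f)
    (x : ZMod Lx) (y : ZMod Ly) (k : ℕ) : f (x, y + 6 * k) = f (x, y) := by
  induction k with
  | zero => simp
  | succ k ih =>
    rw [← ih]
    have h1 := hf.2 x (y + 6 * k + 6)
    have h2 := hf.2 x (y + 6 * k + 4)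
    rw [show y + 6 * k + 6 - 2 = y + 6 * k + 4 by ring,
      show y + 6 * k + 6 - 4 = y + 6 * k + 2 by ring] at h1
    rw [show y + 6 * k + 4 - 2 = y + 6 * k + 2 by ring,
      show y + 6 * k + 4 - 4 = y + 6 * k by ring] at h2
    rw [show y + 6 * ((k + 1 : ℕ) : ZMod Ly) = y + 6 * k + 6 by push_cast; ring]
    linear_combination h1 - h2

theorem IsColumnPeriodic.apply_eq_zero {f : Torus Lx Ly → ZMod 2} (hf : IsColumnPeriodic f)
    {x : ZMod Lx} {y : ZMod Ly} (h0 : f (x, y) = 0) (h1 : f (x, y + 2) = 0) (k i : ℕ) :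
    f (x + 2 * k, y + 2 * i) = 0 := by
  rw [hf.apply_add]
  suffices f (x, y + 2 * i) = 0 ∧ f (x, y + 2 * (i + 1 : ℕ)) = 0 from this.1
  induction i with
  | zero => simp [h0, h1]
  | succ i ih =>
    refine ⟨ih.2, ?_⟩
    have h := hf.2 x (y + 2 * (i + 1 + 1 : ℕ))
    rw [show y + 2 * ((i + 1 + 1 : ℕ) : ZMod Ly) - 2 = y + 2 * (i + 1 : ℕ) by push_cast; ring,
      show y + 2 * ((i + 1 + 1 : ℕ) : ZMod Ly) - 4 = y + 2 * i by push_cast; ring,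
      ih.1, ih.2] at h
    simpa using h

theorem IsColumnPeriodic.eq_zero_of_not_six_dvd {f : Torus Lx Ly → ZMod 2}
    (hf : IsColumnPeriodic f) (hy : 2 ∣ Ly) (h6 : ¬ 6 ∣ Ly) [NeZero Ly] : f = 0 := by
  have h3 : Nat.Coprime 3 Ly := (Nat.Prime.coprime_iff_not_dvd Nat.prime_three).2 (by omega)
  have hinv : (((3 : ZMod Ly)⁻¹).val : ZMod Ly) * 3 = 1 := by
    rw [ZMod.natCast_zmod_val, mul_comm]
    exact_mod_cast ZMod.coe_mul_inv_eq_one 3 h3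
  have hstep (x : ZMod Lx) (y : ZMod Ly) : f (x, y + 2) = f (x, y) := by
    rw [← hf.apply_add_six x y ((3 : ZMod Ly)⁻¹).val]
    congr 2
    linear_combination -2 * hinv
  funext ⟨x, y⟩
  have h := hf.2 x y
  have hs := hstep x (y - 4)
  rw [show y - 4 + 2 = y - 2 by ring] at hs
  have two : (2 : ZMod 2) = 0 := by decide
  change f (x, y) = 0
  linear_combination h + hs - f (x, y - 2) * two

/-- Restriction of a kernel vector to two ancillas of its row class at
vertical distance `2`. -/
noncomputable def kernelEval (Lx Ly : ℕ) [NeZero Lx] [NeZero Ly] (hx : 2 ∣ Lx) (hy : 2 ∣ Ly)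
    (ε : ZMod 2) :
    LinearMap.ker (rowCheck Lx Ly hx hy ε).transpose.mulVecLin →ₗ[ZMod 2] ZMod 2 × ZMod 2 :=
  ((LinearMap.proj ⟨_, baseSite_mem 0 0⟩).prod (LinearMap.proj ⟨_, baseSite_mem 0 1⟩)).comp
    (Submodule.subtype _)

theorem kernelEval_apply [NeZero Lx] [NeZero Ly]
    (v : LinearMap.ker (rowCheck Lx Ly hx hy ε).transpose.mulVecLin) :
    kernelEval Lx Ly hx hy ε v =
      (extendByZero v.1 (baseSite Lx Ly ε),
        extendByZero v.1 ((baseSite Lx Ly ε).1, (baseSite Lx Ly ε).2 + 2)) := by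
  have h (i : ℕ) := extendByZero_coe v.1 ⟨_, baseSite_mem 0 i⟩
  refine Prod.ext ((h 0).symm.trans ?_) ((h 1).symm.trans ?_) <;> simp

theorem isColumnPeriodic_of_mem_ker [NeZero Lx] [NeZero Ly]
    (v : LinearMap.ker (rowCheck Lx Ly hx hy ε).transpose.mulVecLin) :
    IsColumnPeriodic (extendByZero v.1) :=
  isColumnPeriodic_of_mulVec_eq_zero v.2

theorem kernelEval_injective [NeZero Lx] [NeZero Ly] :
    Function.Injective (kernelEval Lx Ly hx hy ε) := by
  refine (injective_iff_map_eq_zero _).2 fun v hv => ?_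
  rw [kernelEval_apply, Prod.mk_eq_zero] at hv
  refine Subtype.ext (funext fun a => ?_)
  change v.1 a = 0
  rw [← extendByZero_coe v.1 a]
  obtain ⟨k, i, h⟩ := exists_eq_baseSite_add a.2
  rw [h]
  exact (isColumnPeriodic_of_mem_ker v).apply_eq_zero hv.1 hv.2 k i

/-- The function on `ZMod 3` with values `α` at `e`, `β` at `e + 2`, and total sum zero. -/
def balanced (e : ZMod 3) (α β : ZMod 2) (z : ZMod 3) : ZMod 2 :=
  if z = e then α else if z = e + 2 then β else α + β

theorem balanced_sum (e : ZMod 3) (α β : ZMod 2) (z : ZMod 3) :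
    balanced e α β z + balanced e α β (z - 2) + balanced e α β (z - 4) = 0 := by
  revert e α β z
  decide

theorem kernelEval_surjective [NeZero Lx] [NeZero Ly] (h3 : 3 ∣ Ly) :
    Function.Surjective (kernelEval Lx Ly hx hy ε) := by
  rintro ⟨α, β⟩
  have hx2 (x) := castHom_sub_even hx x 2 even_two
  have hy2 (y) := castHom_sub_even hy y 2 even_two
  have hy4 (y) := castHom_sub_even hy y 4 (by decide)
  let g : ZMod Ly → ZMod 2 := fun y =>
    balanced (ε.val : ZMod 3) α β (ZMod.castHom h3 (ZMod 3) y)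
  let v : RowAncilla Lx Ly hx hy ε → ZMod 2 := fun a => g a.1.2
  have hmem (x : ZMod Lx) (y : ZMod Ly) (h : torusParity hx hy (x, y) = 1 ∧
      ZMod.castHom hy (ZMod 2) y = ε) : extendByZero v (x, y) = g y :=
    extendByZero_coe v ⟨(x, y), h⟩
  have hv : IsColumnPeriodic (extendByZero v) := by
    refine ⟨fun x y => ?_, fun x y => ?_⟩
    · by_cases h : torusParity hx hy (x, y) = 1 ∧ ZMod.castHom hy (ZMod 2) y = ε
      · rw [hmem _ _ h, hmem _ _ (by simpa only [torusParity, hx2, hy2, hy4] using h)]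
      · rw [extendByZero_eq_zero _ h,
          extendByZero_eq_zero _ (by simpa only [torusParity, hx2, hy2, hy4] using h)]
    · by_cases h : torusParity hx hy (x, y) = 1 ∧ ZMod.castHom hy (ZMod 2) y = ε
      · rw [hmem _ _ h, hmem _ _ (by simpa only [torusParity, hx2, hy2, hy4] using h),
          hmem _ _ (by simpa only [torusParity, hx2, hy2, hy4] using h)]
        simpa only [g, map_sub, map_ofNat] using balanced_sum _ α β _
      · rw [extendByZero_eq_zero _ h,
          extendByZero_eq_zero _ (by simpa only [torusParity, hx2, hy2, hy4] using h),
          extendByZero_eq_zero _ (by simpa only [torusParity, hx2, hy2, hy4] using h),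
          add_zero, add_zero]
  refine ⟨⟨v, mulVec_eq_zero_of_isColumnPeriodic hv⟩, ?_⟩
  have b0 := baseSite_mem (hx := hx) (hy := hy) (ε := ε) 0 0
  have b1 := baseSite_mem (hx := hx) (hy := hy) (ε := ε) 0 1
  simp only [Nat.cast_zero, Nat.cast_one, mul_zero, mul_one, add_zero] at b0 b1
  rw [kernelEval_apply]
  refine Prod.ext ((hmem _ _ b0).trans ?_) ((hmem _ _ b1).trans ?_)
  · simp [-ZMod.castHom_apply, -ZMod.natCast_val, g, balanced, baseSite]
  · have two_ne : (2 : ZMod 3) ≠ 0 := by decide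
    simp [-ZMod.castHom_apply, -ZMod.natCast_val, map_ofNat, g, balanced, baseSite, two_ne]

theorem finrank_ker_of_six_dvd [NeZero Lx] [NeZero Ly] (h6 : 6 ∣ Ly) :
    Module.finrank (ZMod 2) (LinearMap.ker (rowCheck Lx Ly hx hy ε).transpose.mulVecLin) = 2 := by
  rw [(LinearEquiv.ofBijective _ ⟨kernelEval_injective,
    kernelEval_surjective ((by norm_num : 3 ∣ 6).trans h6)⟩).finrank_eq]
  simp

theorem finrank_ker_of_not_six_dvd [NeZero Lx] [NeZero Ly] (h6 : ¬ 6 ∣ Ly) :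
    Module.finrank (ZMod 2) (LinearMap.ker (rowCheck Lx Ly hx hy ε).transpose.mulVecLin) = 0 := by
  rw [Submodule.finrank_eq_zero, LinearMap.ker_eq_bot']
  refine fun v hv => funext fun a => ?_
  rw [← extendByZero_coe v a,
    (isColumnPeriodic_of_mulVec_eq_zero hv).eq_zero_of_not_six_dvd hy h6, Pi.zero_apply,
    Pi.zero_apply]

theorem rank_add_finrank_ker [NeZero Lx] [NeZero Ly] :
    (rowCheck Lx Ly hx hy ε).rank +
      Module.finrank (ZMod 2) (LinearMap.ker (rowCheck Lx Ly hx hy ε).transpose.mulVecLin) =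
      Fintype.card (RowAncilla Lx Ly hx hy ε) := by
  rw [← Matrix.rank_transpose, Matrix.rank, LinearMap.finrank_range_add_finrank_ker,
    Module.finrank_fintype_fun_eq_card]

/-- The logical dimension is twice the common dimension of the two left kernels. -/
theorem kDim_eq_two_mul [NeZero Lx] [NeZero Ly] {r : ℕ}
    (hr : ∀ ε, Module.finrank (ZMod 2)
      (LinearMap.ker (rowCheck Lx Ly hx hy ε).transpose.mulVecLin) = r) :
    kDim Lx Ly hx hy = 2 * r := by
  have r0 := rank_add_finrank_ker (hx := hx) (hy := hy) (ε := 0)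
  have r1 := rank_add_finrank_ker (hx := hx) (hy := hy) (ε := 1)
  rw [hr] at r0 r1
  have c0 := card_rowAncilla_mul_four hx hy 0
  have c1 := card_rowAncilla_mul_four hx hy 1
  have cd := card_dataSite_mul_two hx hy
  change Fintype.card (DataSite Lx Ly hx hy) - (rowCheck Lx Ly hx hy 0).rank -
    (rowCheck Lx Ly hx hy 1).rank = 2 * r
  omega

end Kernel

/-- for even positive `d`, the directional CSS construction of
`W = NE²NE²N` with the row-alternating layout on the thin-rectangle torus
`(L_x, L_y) = (2d, d)` has `n = d²` data qubits and its logical dimension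
satisfies `k = 4` if `6 ∣ d`, and `k = 0` otherwise. -/
theorem thin_rectangle_kcollapse (d : ℕ) [NeZero d] [NeZero (2 * d)] (hd : 2 ∣ d) :
    Fintype.card (DataSite (2 * d) d (dvd_mul_right 2 d) hd) = d ^ 2 ∧
      (6 ∣ d → kDim (2 * d) d (dvd_mul_right 2 d) hd = 4) ∧
      (¬ 6 ∣ d → kDim (2 * d) d (dvd_mul_right 2 d) hd = 0) := by
  refine ⟨?_, fun h6 => ?_, fun h6 => ?_⟩
  · refine Nat.eq_of_mul_eq_mul_right two_pos ?_
    rw [card_dataSite_mul_two]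
    ring
  · exact kDim_eq_two_mul fun _ => finrank_ker_of_six_dvd h6
  · exact kDim_eq_two_mul fun _ => finrank_ker_of_not_six_dvd h6
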